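/- Let v = branch ℓ z o be an ordered ZDD node. Then the map S ↦ S ∪ {ℓ} is injective on F(o), and the cardinality of F(v) equals the cardinality of F(o) plus the cardinality of F(z): |F(branch ℓ z o)| = |F(o)| + |F(z)|. -/

import Mathlib

inductive Z : Type
  | bot : Z
  | top : Z
  | branch (ℓ : ℕ) (z o : Z) : Z

open Z

/-- The set family of finite sets of naturals represented by a ZDD node. -/
def F : Z → Finset (Finset ℕ)
  | bot => ∅
  | top => {∅}
  | branch ℓ z o => (F o).image (fun S => S ∪ {ℓ}) ∪ F z

/-- The labels occurring in a ZDD node. -/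
def labels : Z → Finset ℕ
  | bot => ∅
  | top => ∅
  | branch ℓ z o => insert ℓ (labels z ∪ labels o)

/-- A ZDD node is ordered if labels strictly increase along every
root-to-terminal path. -/
def Ordered : Z → Prop
  | bot => True
  | top => True
  | branch ℓ z o =>
      (∀ m ∈ labels z, ℓ < m) ∧ (∀ m ∈ labels o, ℓ < m) ∧ Ordered z ∧ Ordered o

theorem subset_labels_of_mem_F (v : Z) : ∀ S ∈ F v, S ⊆ labels v := by
  induction v with
  | bot => simp [F]
  | top => simp [F]
  | branch ℓ z o ihz iho =>
    intro S hS
    simp only [F, Finset.mem_union, Finset.mem_image] at hS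
    intro x hx
    simp only [labels, Finset.mem_insert, Finset.mem_union]
    rcases hS with ⟨T, hT, rfl⟩ | hS
    · rcases Finset.mem_union.1 hx with hx | hx
      · exact Or.inr (Or.inr (iho T hT hx))
      · exact Or.inl (Finset.mem_singleton.1 hx)
    · exact Or.inr (Or.inl (ihz S hS hx))

/-- A number below every label of `v` lies in no set of the family of `v`. -/
theorem notMem_of_mem_F {v : Z} {ℓ : ℕ} (h : ∀ m ∈ labels v, ℓ < m) {S : Finset ℕ}
    (hS : S ∈ F v) : ℓ ∉ S :=
  fun hℓ => (h ℓ (subset_labels_of_mem_F v S hS hℓ)).false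

theorem stmt_3 (ℓ : ℕ) (z o : Z) (h : Ordered (Z.branch ℓ z o)) :
    Set.InjOn (fun S : Finset ℕ => S ∪ {ℓ}) ↑(F o) ∧
      (F (Z.branch ℓ z o)).card = (F o).card + (F z).card := by
  obtain ⟨hz, ho, -, -⟩ := h
  have hinj : Set.InjOn (fun S : Finset ℕ => S ∪ {ℓ}) ↑(F o) := by
    intro S hS T hT hST
    have hS' := notMem_of_mem_F ho (Finset.mem_coe.1 hS)
    have hT' := notMem_of_mem_F ho (Finset.mem_coe.1 hT)
    ext x
    have hx := Finset.ext_iff.1 hST x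
    simp only [Finset.mem_union, Finset.mem_singleton] at hx
    grind
  refine ⟨hinj, ?_⟩
  rw [F, Finset.card_union_of_disjoint, Finset.card_image_of_injOn hinj]
  rw [Finset.disjoint_left]
  intro S hS hSz
  obtain ⟨T, -, rfl⟩ := Finset.mem_image.1 hS
  exact notMem_of_mem_F hz hSz (by simp)
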